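/- In the individual-comparison model where each of m users contributes L comparisons, suppose the link function F satisfies conditions (A0), (A1) and (A2). If the Laplace noise scale satisfies λ ≥ 8Lκ₁/ε and the ridge penalty satisfies γ ≥ 8Lκ₂/ε, then the perturbed maximum likelihood estimator θ̃ = argmin_{θ∈ℝⁿ} L(θ;y) + (γ/2)‖θ‖₂² + wᵀθ, with w₁,…,w_n i.i.d. Laplace(λ), is (ε,0)-individually-differentially private: for any two datasets differing only in the L comparisons of a single user, and any measurable A, P(θ̃(y)∈A) ≤ e^ε P(θ̃(y′)∈A). -/

import Mathlib

open MeasureTheory ProbabilityTheory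
open scoped ENNReal

namespace PrivateRanking

instance : MeasurableSpace (Option Bool) := ⊤

/-- The index set of potential comparisons: ordered pairs `(i, j)` with `i < j`. -/
abbrev Pair (n : ℕ) := {q : Fin n × Fin n // q.1 < q.2}

/-- A dataset of pairwise comparisons: for each pair `(i,j)` with `i < j`, either `none`
(the pair was not compared) or `some b`, where `b = true` iff item `i` beat item `j`. -/
abbrev EdgeData (n : ℕ) := Pair n → Option Bool

/-- Edge adjacency: either the comparison graphs are identical and exactly one comparison
outcome differs, or the graphs differ by exactly one edge and all outcomes on common
edges agree. -/
def EdgeAdjacent {n : ℕ} (d d' : EdgeData n) : Prop :=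
  (∃ q, (d q).isSome ∧ (d' q).isSome ∧ d q ≠ d' q ∧ ∀ r, r ≠ q → d r = d' r) ∨
  (∃ q₁ q₂, q₁ ≠ q₂ ∧ (d q₁).isSome ∧ d' q₁ = none ∧ d q₂ = none ∧ (d' q₂).isSome ∧
    ∀ r, r ≠ q₁ → r ≠ q₂ → d r = d' r)

/-- Contribution of a single observed comparison with outcome `b` to the negative
log-likelihood: `-y log F - (1-y) log (1-F)`. -/
noncomputable def nllTerm (F : ℝ → ℝ) (x : ℝ) (b : Bool) : ℝ :=
  if b then -Real.log (F x) else -Real.log (1 - F x)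

/-- The negative log-likelihood `L(θ; y)` of the comparison data `d`. -/
noncomputable def nll (n : ℕ) (F : ℝ → ℝ) (θ : Fin n → ℝ) (d : EdgeData n) : ℝ :=
  ∑ q : Pair n, (d q).elim 0 (fun b => nllTerm F (θ q.1.1 - θ q.1.2) b)

/-- The perturbed and ridge-regularized objective
`L(θ; y) + (γ/2)‖θ‖₂² + wᵀθ`. -/
noncomputable def pobj (n : ℕ) (F : ℝ → ℝ) (γ : ℝ) (w : Fin n → ℝ) (d : EdgeData n)
    (θ : Fin n → ℝ) : ℝ :=
  nll n F θ d + γ / 2 * ∑ i, θ i ^ 2 + ∑ i, w i * θ i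

/-- The Laplace distribution with scale `b`, via its density `(2b)⁻¹ exp (-|x|/b)`. -/
noncomputable def laplaceMeasure (b : ℝ) : Measure ℝ :=
  volume.withDensity fun x => ENNReal.ofReal ((2 * b)⁻¹ * Real.exp (-|x| / b))

/-- The law of `n` i.i.d. Laplace(b) random variables. -/
noncomputable def laplacePi (n : ℕ) (b : ℝ) : Measure (Fin n → ℝ) :=
  Measure.pi fun _ => laplaceMeasure b

/-- (A0): `F` is strictly increasing and symmetric, `F x = 1 - F (-x)`. -/
def CondA0 (F : ℝ → ℝ) : Prop := StrictMono F ∧ ∀ x, F x = 1 - F (-x)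

/-- (A1): `sup_x |F'(x)/(F(x)(1-F(x)))| < κ₁`. -/
def CondA1 (F : ℝ → ℝ) (κ₁ : ℝ) : Prop :=
  0 < κ₁ ∧ Differentiable ℝ F ∧ ∀ x, |deriv F x / (F x * (1 - F x))| < κ₁

/-- (A2): `(-log F)'' > 0` everywhere, `(-log F)'' < κ₂`, and
`(-log F)'' > 1/κ₂` on `[-4, 4]`. -/
def CondA2 (F : ℝ → ℝ) (κ₂ : ℝ) : Prop :=
  0 < κ₂ ∧ (∀ x, 0 < deriv (deriv fun y => -Real.log (F y)) x) ∧
    (∀ x, deriv (deriv fun y => -Real.log (F y)) x < κ₂) ∧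
    (∀ x, |x| ≤ 4 → κ₂⁻¹ < deriv (deriv fun y => -Real.log (F y)) x)

/-- A dataset in the individual-comparison model: each of `m` users reports `L`
comparisons, each consisting of a pair `(i,j)` with `i < j` together with the outcome
(`true` iff the lower-indexed item `i` won). -/
abbrev IndData (n m L : ℕ) := Fin m → Fin L → Pair n × Bool

/-- Individual adjacency: the two datasets agree on the comparisons of every user
except (at most) one. -/
def IndAdjacent {n m L : ℕ} (d d' : IndData n m L) : Prop :=
  ∃ k₀, ∀ k, k ≠ k₀ → d k = d' k

/-- The negative log-likelihood in the individual-comparison model. -/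
noncomputable def nllInd (n m L : ℕ) (F : ℝ → ℝ) (θ : Fin n → ℝ)
    (d : IndData n m L) : ℝ :=
  ∑ k, ∑ l, nllTerm F (θ (d k l).1.1.1 - θ (d k l).1.1.2) (d k l).2

/-- The perturbed, ridge-regularized objective in the individual-comparison model. -/
noncomputable def pobjInd (n m L : ℕ) (F : ℝ → ℝ) (γ : ℝ) (w : Fin n → ℝ)
    (d : IndData n m L) (θ : Fin n → ℝ) : ℝ :=
  nllInd n m L F θ d + γ / 2 * ∑ i, θ i ^ 2 + ∑ i, w i * θ i

/-- The probability weight of a single reported comparison `(q, b)` in the individual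
model: the pair is uniform among the `n choose 2` pairs and the lower-indexed item
wins with probability `ρwin`. -/
noncomputable def indWeight (n : ℕ) (ρwin : ℝ) (b : Bool) : ℝ :=
  (n.choose 2 : ℝ)⁻¹ * (if b then ρwin else 1 - ρwin)

/-- `data` follows the parametric individual-comparison model: all `mL` comparisons are
independent, each pair is uniform, and item `i` beats `j` with probability
`F (θ i - θ j)`. -/
def IsIndParamModel {Ω : Type*} [MeasurableSpace Ω] (μ : Measure Ω) (n m L : ℕ)
    (F : ℝ → ℝ) (θ : Fin n → ℝ) (data : Ω → IndData n m L) : Prop :=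
  Measurable data ∧
    ∀ d : IndData n m L, μ {ω | data ω = d} =
      ∏ k, ∏ l, ENNReal.ofReal
        (indWeight n (F (θ (d k l).1.1.1 - θ (d k l).1.1.2)) (d k l).2)

theorem lint_prod : ∀ {n : ℕ} (μ : Fin n → Measure ℝ) [∀ i, SigmaFinite (μ i)] (f : Fin n → ℝ → ℝ≥0∞)
    (_ : ∀ i, Measurable (f i)), ∫⁻ x, ∏ i, f i (x i) ∂(Measure.pi μ) = ∏ i, ∫⁻ x, f i x ∂(μ i) := by
  intro n
  induction n with
  | zero => intro μ _ f _; simp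
  | succ n ih =>
    intro μ _ f hf
    have := ((measurePreserving_piFinSuccAbove μ 0).symm)
    rw [← this.lintegral_comp_emb (MeasurableEquiv.measurableEmbedding _)]
    simp only [Fin.prod_univ_succ, MeasurableEquiv.piFinSuccAbove_symm_apply, Fin.insertNthEquiv,
      Equiv.coe_fn_mk, Fin.insertNth_zero, Fin.cons_zero, Fin.cons_succ, Fin.zero_succAbove]
    rw [← ih (fun i => μ i.succ) (fun i => f i.succ) (fun i => hf _)]
    have := lintegral_prod_mul (μ := μ 0) (ν := Measure.pi fun i : Fin n => μ i.succ) (f := f 0) (g := fun x => ∏ i : Fin n, f i.succ (x i)) (hf 0).aemeasurable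
      (Finset.measurable_prod _ (fun i _ => (hf _).comp (measurable_pi_apply i))).aemeasurable
    exact this

theorem pi_lap (n : ℕ) (b : ℝ) : (Measure.pi fun _ : Fin n => laplaceMeasure b) =
    volume.withDensity (fun x : Fin n → ℝ => ∏ i, ENNReal.ofReal ((2 * b)⁻¹ * Real.exp (-|x i| / b))) := by
  have : SigmaFinite (laplaceMeasure b) := by unfold laplaceMeasure; exact SigmaFinite.withDensity_ofReal _
  refine Measure.pi_eq (fun s hs => ?_)
  rw [withDensity_apply _ (MeasurableSet.univ_pi hs), volume_pi, Measure.restrict_pi_pi]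
  rw [lint_prod (fun i => volume.restrict (s i)) (fun i x => ENNReal.ofReal ((2 * b)⁻¹ * Real.exp (-|x| / b))) (fun i => by fun_prop)]
  simp only [laplaceMeasure]
  exact Finset.prod_congr rfl fun i _ => (withDensity_apply _ (hs i)).symm

theorem lap_ratio {n : ℕ} {b : ℝ} (hb : 0 < b) (w w' : Fin n → ℝ) (c : ℝ) (h : ∑ i, |w i - w' i| ≤ c * b) :
    ∏ i, ENNReal.ofReal ((2 * b)⁻¹ * Real.exp (-|w i| / b)) ≤ ENNReal.ofReal (Real.exp c) *
    ∏ i, ENNReal.ofReal ((2 * b)⁻¹ * Real.exp (-|w' i| / b)) := by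
  rw [← ENNReal.ofReal_prod_of_nonneg (fun _ _ => by positivity), ← ENNReal.ofReal_prod_of_nonneg (fun _ _ => by positivity),
    ← ENNReal.ofReal_mul (by positivity)]
  apply ENNReal.ofReal_le_ofReal
  simp only [Finset.prod_mul_distrib, ← Real.exp_sum]
  rw [mul_left_comm, ← Real.exp_add]
  gcongr
  rw [← Finset.sum_div, ← Finset.sum_div, div_le_iff₀ hb, add_mul, div_mul_cancel₀ _ hb.ne']
  have : ∑ i, (|w' i| - |w i|) ≤ ∑ i, |w i - w' i| := Finset.sum_le_sum fun i _ => by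
    rw [abs_sub_comm]; exact abs_sub_abs_le_abs_sub _ _
  simp only [Finset.sum_sub_distrib, Finset.sum_neg_distrib] at *
  linarith

section
open Matrix
def Good {n : ℕ} (γ : ℝ) (M : Matrix (Fin n) (Fin n) ℝ) : Prop :=
  M.IsHermitian ∧ ∀ x : Fin n → ℝ, γ * (x ⬝ᵥ x) ≤ x ⬝ᵥ (M *ᵥ x)

theorem Good.add {n : ℕ} {γ : ℝ} {M : Matrix (Fin n) (Fin n) ℝ} (h : Good γ M) {c : ℝ} (hc : 0 ≤ c) (v : Fin n → ℝ) :
    Good γ (M + c • vecMulVec v v) := by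
  refine ⟨h.1.add ?_, fun x => ?_⟩
  · ext i j; simp [vecMulVec_apply, mul_comm]
  · have := h.2 x
    rw [add_mulVec, dotProduct_add, smul_mulVec, vecMulVec_mulVec]
    have h2 : x ⬝ᵥ (c • (MulOpposite.op (v ⬝ᵥ x) • v)) = c * (v ⬝ᵥ x)^2 := by
      simp [dotProduct_smul, dotProduct_comm x v]; left; ring
    rw [h2]; nlinarith [mul_nonneg hc (sq_nonneg (v ⬝ᵥ x))]

theorem Good.sum {n : ℕ} {γ : ℝ} {M : Matrix (Fin n) (Fin n) ℝ} (h : Good γ M) {ι : Type*} (S : Finset ι)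
    (c : ι → ℝ) (hc : ∀ t, 0 ≤ c t) (v : ι → Fin n → ℝ) :
    Good γ (M + ∑ t ∈ S, c t • vecMulVec (v t) (v t)) := by
  classical
  induction S using Finset.induction_on with
  | empty => simpa using h
  | insert a s ha ih =>
    rw [Finset.sum_insert ha, add_comm (c a • _), ← add_assoc]
    exact ih.add (hc a) _

theorem Good.det_pos {n : ℕ} {γ : ℝ} (hγ : 0 < γ) {M : Matrix (Fin n) (Fin n) ℝ} (h : Good γ M) : 0 < M.det := by
  apply PosDef.det_pos
  refine PosDef.of_dotProduct_mulVec_pos h.1 fun x hx => ?_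
  have := h.2 x
  have h2 : 0 < x ⬝ᵥ x := by
    have := dotProduct_self_star_pos_iff.2 hx
    simpa using this
  simp only [star_trivial]
  nlinarith

theorem Good.det_add {n : ℕ} {γ : ℝ} (hγ : 0 < γ) {M : Matrix (Fin n) (Fin n) ℝ} (h : Good γ M) {c K : ℝ} (hc : 0 ≤ c) (hK : c ≤ K) (v : Fin n → ℝ)
    (hv : v ⬝ᵥ v = 2) :
    M.det ≤ (M + c • vecMulVec v v).det ∧ (M + c • vecMulVec v v).det ≤ Real.exp (2 * K / γ) * M.det := by
  have hd := h.det_pos hγ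
  have hu : IsUnit M.det := hd.ne'.isUnit
  have e : (M + c • vecMulVec v v).det = M.det * (1 + c * (v ⬝ᵥ (M⁻¹ *ᵥ v))) := by
    have := det_add_replicateCol_mul_replicateRow (ι := Unit) hu (c • v) v
    rw [← smul_vecMulVec, vecMulVec_eq Unit, this, det_unique (n := Unit)]
    congr 1
    simp only [Matrix.add_apply, Matrix.one_apply_eq]
    congr 1
    rw [Matrix.mul_assoc, ← replicateCol_mulVec, mulVec_smul]
    simp [Matrix.mul_apply, dotProduct, Finset.mul_sum]
    exact Finset.sum_congr rfl fun _ _ => by ring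
  set u := M⁻¹ *ᵥ v with hu'
  have hMu : M *ᵥ u = v := by rw [hu', mulVec_mulVec, mul_nonsing_inv _ hu, one_mulVec]
  have h1 := h.2 u
  rw [hMu] at h1
  have h0 : 0 ≤ u ⬝ᵥ u := by simpa using dotProduct_self_star_nonneg u
  have h3 : 0 ≤ (γ • u - v) ⬝ᵥ (γ • u - v) := by simpa using dotProduct_self_star_nonneg (γ • u - v)
  have h4 : (γ • u - v) ⬝ᵥ (γ • u - v) = γ^2 * (u ⬝ᵥ u) - 2 * γ * (u ⬝ᵥ v) + v ⬝ᵥ v := by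
    simp [sub_dotProduct, dotProduct_sub, dotProduct_comm v u]; ring
  rw [h4, hv] at h3
  rw [e, dotProduct_comm v u]
  have huv : 0 ≤ u ⬝ᵥ v := le_trans (by positivity) h1
  have huv2 : u ⬝ᵥ v ≤ 2 / γ := by
    rw [le_div_iff₀ hγ]; nlinarith
  constructor
  · nlinarith [mul_nonneg hd.le (mul_nonneg hc huv)]
  · rw [mul_comm]
    gcongr
    have : c * (u ⬝ᵥ v) ≤ 2 * K / γ := by
      calc c * (u ⬝ᵥ v) ≤ K * (2 / γ) := by gcongr; exact hc.trans hK
        _ = _ := by ring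
    linarith [Real.add_one_le_exp (2 * K / γ)]

theorem Good.det_sum {n : ℕ} {γ : ℝ} (hγ : 0 < γ) {M : Matrix (Fin n) (Fin n) ℝ} (h : Good γ M) {ι : Type*} (S : Finset ι)
    (c : ι → ℝ) {K : ℝ} (hc : ∀ t, 0 ≤ c t) (hK : ∀ t, c t ≤ K) (v : ι → Fin n → ℝ) (hv : ∀ t, v t ⬝ᵥ v t = 2) :
    M.det ≤ (M + ∑ t ∈ S, c t • vecMulVec (v t) (v t)).det ∧
     (M + ∑ t ∈ S, c t • vecMulVec (v t) (v t)).det ≤ Real.exp (S.card * (2 * K / γ)) * M.det := by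
  classical
  induction S using Finset.induction_on with
  | empty => simp
  | insert a s ha ih =>
    rw [Finset.sum_insert ha, add_comm (c a • _), ← add_assoc]
    have := (h.sum s c hc v).det_add hγ (hc a) (hK a) (v a) (hv a)
    refine ⟨ih.1.trans this.1, this.2.trans ?_⟩
    rw [Finset.card_insert_of_notMem ha]
    push_cast
    have e : Real.exp ((s.card + 1) * (2 * K / γ)) = Real.exp (2 * K / γ) * Real.exp (s.card * (2 * K / γ)) := by
      rw [← Real.exp_add]; congr 1; ring
    rw [e, mul_assoc]
    exact mul_le_mul_of_nonneg_left ih.2 (Real.exp_pos _).le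

theorem F_lt_one {F : ℝ → ℝ} {κ : ℝ} (h0 : CondA0 F) (h1 : CondA1 F κ) (x : ℝ) : F x < 1 := by
  obtain ⟨hm, hs⟩ := h0
  obtain ⟨hκ, hd, hb⟩ := h1
  have hF0 : F 0 = 1/2 := by have := hs 0; simp at this; linarith
  by_contra hx
  push Not at hx
  have hx0 : 0 ≤ x := by
    by_contra h
    push Not at h
    have := hm h
    linarith
  obtain ⟨y, hy, hFy⟩ := intermediate_value_Icc hx0 hd.continuous.continuousOn (show (1:ℝ) ∈ Set.Icc (F 0) (F x) from ⟨by linarith, hx⟩)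
  have hg : ∀ t, HasDerivAt (fun t => (1 - F t) * Real.exp (κ * t)) ((-deriv F t) * Real.exp (κ * t) + (1 - F t) * (Real.exp (κ * t) * κ)) t := by
    intro t
    have a := ((hd t).hasDerivAt.const_sub 1)
    have b := ((hasDerivAt_id t).const_mul κ).exp
    have := a.mul b
    simp only [id, mul_one] at this
    exact this
  have mono : MonotoneOn (fun t => (1 - F t) * Real.exp (κ * t)) (Set.Icc 0 y) := by
    refine monotoneOn_of_deriv_nonneg (convex_Icc _ _) (fun t _ => (hg t).continuousAt.continuousWithinAt) (fun t _ => (hg t).differentiableAt.differentiableWithinAt) ?_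
    intro t ht
    rw [interior_Icc] at ht
    rw [(hg t).deriv]
    have l1 : F t < 1 := hFy ▸ hm ht.2
    have l0 : 1/2 < F t := hF0 ▸ hm ht.1
    have := (abs_lt.1 (hb t)).2
    have hp : 0 < F t * (1 - F t) := mul_pos (by linarith) (by linarith)
    rw [div_lt_iff₀ hp] at this
    have h3 : deriv F t ≤ κ * (1 - F t) := by
      nlinarith [mul_pos hκ (sub_pos.2 l1)]
    nlinarith [Real.exp_pos (κ * t)]
  have := mono (Set.left_mem_Icc.2 hy.1) (Set.right_mem_Icc.2 hy.1) hy.1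
  simp [hFy, hF0] at this
  norm_num at this

theorem F_pos {F : ℝ → ℝ} {κ : ℝ} (h0 : CondA0 F) (h1 : CondA1 F κ) (x : ℝ) : 0 < F x := by
  rw [h0.2 x]; linarith [F_lt_one h0 h1 (-x)]

theorem phi_bound {F : ℝ → ℝ} {κ : ℝ} (h0 : CondA0 F) (h1 : CondA1 F κ) (x : ℝ) :
   DifferentiableAt ℝ (fun y => -Real.log (F y)) x ∧ |deriv (fun y => -Real.log (F y)) x| ≤ κ := by
  have hp := F_pos h0 h1 x
  have hl := F_lt_one h0 h1 x
  have hd := ((h1.2.1 x).hasDerivAt.log hp.ne').neg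
  have e : (-fun y => Real.log (F y)) = (fun y => -Real.log (F y)) := rfl
  try rw [e] at hd
  refine ⟨hd.differentiableAt, ?_⟩
  rw [hd.deriv, abs_neg]
  have := (h1.2.2 x).le
  have e2 : deriv F x / F x = deriv F x / (F x * (1 - F x)) * (1 - F x) := by
    have : (1 - F x) ≠ 0 := by linarith
    field_simp
  rw [e2, abs_mul, abs_of_pos (show 0 < 1 - F x by linarith)]
  nlinarith [h1.1, abs_nonneg (deriv F x / (F x * (1 - F x)))]

noncomputable def LL {n : ℕ} (v : Fin n → ℝ) : (Fin n → ℝ) →L[ℝ] ℝ := ∑ i, v i • ContinuousLinearMap.proj (R := ℝ) i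
theorem LL_apply {n : ℕ} (v x : Fin n → ℝ) : LL v x = v ⬝ᵥ x := by
  simp [LL, dotProduct]

noncomputable def GG {n : ℕ} {ι : Type*} (S : Finset ι) (φ' : ℝ → ℝ) (γ : ℝ) (v : ι → Fin n → ℝ) (θ : Fin n → ℝ) : Fin n → ℝ :=
  -(γ • θ + ∑ t ∈ S, φ' (v t ⬝ᵥ θ) • v t)

noncomputable def HH {n : ℕ} {ι : Type*} (S : Finset ι) (φ'' : ℝ → ℝ) (γ : ℝ) (v : ι → Fin n → ℝ) (θ : Fin n → ℝ) : Matrix (Fin n) (Fin n) ℝ :=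
  γ • 1 + ∑ t ∈ S, φ'' (v t ⬝ᵥ θ) • vecMulVec (v t) (v t)

theorem GG_deriv {n : ℕ} {ι : Type*} (S : Finset ι) (φ' φ'' : ℝ → ℝ) (hφ : ∀ x, HasDerivAt φ' (φ'' x) x) (γ : ℝ) (v : ι → Fin n → ℝ) (θ : Fin n → ℝ) :
    HasFDerivAt (GG S φ' γ v) (LinearMap.toContinuousLinearMap (Matrix.toLin' (-(HH S φ'' γ v θ)))) θ := by
  have h1 : ∀ t, HasFDerivAt (fun θ => φ' (v t ⬝ᵥ θ) • v t) ((φ'' (v t ⬝ᵥ θ) • LL (v t)).smulRight (v t)) θ := by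
    intro t
    have := ((LL (v t)).hasFDerivAt (x := θ))
    have h := HasDerivAt.comp_hasFDerivAt θ (hφ _) this
    simp only [LL_apply] at h
    have h' := h.smul_const (v t)
    refine HasFDerivAt.congr_of_eventuallyEq h' (Filter.Eventually.of_forall fun x => ?_)
    simp [LL_apply]
  have h2 := (((hasFDerivAt_id θ).const_smul γ).add (HasFDerivAt.fun_sum (u := S) (fun t _ => h1 t))).neg
  refine (h2.congr_of_eventuallyEq (Filter.Eventually.of_forall fun x => ?_)).congr_fderiv ?_
  · simp [GG]
  · ext1 x
    simp [HH, neg_mulVec, add_mulVec, smul_mulVec, sum_mulVec, vecMulVec_mulVec, LL_apply, smul_smul, mul_comm]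

theorem GG_inj {n : ℕ} {ι : Type*} (S : Finset ι) (φ' : ℝ → ℝ) (hφ : Monotone φ') {γ : ℝ} (hγ : 0 < γ) (v : ι → Fin n → ℝ) :
    Function.Injective (GG S φ' γ v) := by
  intro a b hab
  have h : γ • (a - b) + ∑ t ∈ S, (φ' (v t ⬝ᵥ a) - φ' (v t ⬝ᵥ b)) • v t = 0 := by
    have := neg_injective hab
    simp only [smul_sub, sub_smul, Finset.sum_sub_distrib]
    rw [← sub_eq_zero] at this
    rw [← this]; abel
  have h2 := congrArg (fun z => z ⬝ᵥ (a - b)) h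
  simp only [add_dotProduct, smul_dotProduct, sum_dotProduct, zero_dotProduct, smul_eq_mul] at h2
  have h3 : 0 ≤ ∑ t ∈ S, (φ' (v t ⬝ᵥ a) - φ' (v t ⬝ᵥ b)) * (v t ⬝ᵥ (a - b)) := by
    refine Finset.sum_nonneg fun t _ => ?_
    rw [dotProduct_sub]
    rcases le_total (v t ⬝ᵥ a) (v t ⬝ᵥ b) with h | h
    · have := hφ h
      exact mul_nonneg_of_nonpos_of_nonpos (by linarith) (by linarith)
    · have := hφ h
      exact mul_nonneg (by linarith) (by linarith)
  have h4 : 0 ≤ (a - b) ⬝ᵥ (a - b) := by simpa using dotProduct_self_star_nonneg (a - b)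
  have h5 : (a - b) ⬝ᵥ (a - b) = 0 := by nlinarith [mul_nonneg hγ.le h4]
  exact sub_eq_zero.1 (dotProduct_self_eq_zero.1 h5)

theorem crit {n : ℕ} {ι : Type*} (S : Finset ι) (φ φ' : ℝ → ℝ) (hφ : ∀ x, HasDerivAt φ (φ' x) x) (γ : ℝ) (v : ι → Fin n → ℝ) (w θ : Fin n → ℝ)
    (h : IsMinOn (fun θ => ∑ t ∈ S, φ (v t ⬝ᵥ θ) + γ / 2 * ∑ i, θ i ^ 2 + ∑ i, w i * θ i) Set.univ θ) : GG S φ' γ v θ = w := by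
  have hl := h.isLocalMin Filter.univ_mem
  have h1 : ∀ t, HasFDerivAt (fun θ => φ (v t ⬝ᵥ θ)) (φ' (v t ⬝ᵥ θ) • LL (v t)) θ := by
    intro t
    have := ((LL (v t)).hasFDerivAt (x := θ))
    have h := HasDerivAt.comp_hasFDerivAt θ (hφ _) this
    simp only [LL_apply] at h
    refine HasFDerivAt.congr_of_eventuallyEq h (Filter.Eventually.of_forall fun x => ?_)
    simp [LL_apply]
  have h2 : HasFDerivAt (fun θ : Fin n → ℝ => γ / 2 * ∑ i, θ i ^ 2) (LL (γ • θ)) θ := by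
    have := (HasFDerivAt.fun_sum (u := Finset.univ) (fun i _ => ((ContinuousLinearMap.proj (R := ℝ) (φ := fun _ : Fin n => ℝ) i).hasFDerivAt (x := θ)).pow 2)).const_mul (γ / 2)
    refine this.congr_fderiv ?_
    ext1 x
    simp [LL_apply, dotProduct, Finset.mul_sum]
    exact Finset.sum_congr rfl fun _ _ => by ring
  have h3 : HasFDerivAt (fun θ : Fin n → ℝ => ∑ i, w i * θ i) (LL w) θ := by
    refine (LL w).hasFDerivAt.congr_of_eventuallyEq (Filter.Eventually.of_forall fun x => ?_)
    simp [LL_apply, dotProduct]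
  have h4 := hl.hasFDerivAt_eq_zero (((HasFDerivAt.fun_sum (u := S) (fun t _ => h1 t)).add h2).add h3)
  have h5 : (∑ t ∈ S, φ' (v t ⬝ᵥ θ) • v t) + γ • θ + w = 0 := by
    rw [← dotProduct_self_eq_zero]
    have key : ∀ z, ((∑ t ∈ S, φ' (v t ⬝ᵥ θ) • v t) + γ • θ + w) ⬝ᵥ z = 0 := by
      intro z
      have := congrArg (fun f => f z) h4
      rw [add_dotProduct, add_dotProduct, sum_dotProduct]
      simpa [LL_apply] using this
    exact key _
  rw [GG, neg_eq_iff_eq_neg, eq_neg_iff_add_eq_zero, ← h5]; abel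

theorem HH_split {n : ℕ} {ι : Type*} [Fintype ι] [DecidableEq ι] (p : ι → Prop) [DecidablePred p] (φ'' : ℝ → ℝ) (γ : ℝ) (v : ι → Fin n → ℝ) (θ : Fin n → ℝ) :
    HH Finset.univ φ'' γ v θ = HH (Finset.univ.filter (fun t => ¬ p t)) φ'' γ v θ +
      ∑ t ∈ Finset.univ.filter p, φ'' (v t ⬝ᵥ θ) • vecMulVec (v t) (v t) := by
  rw [HH, HH, ← Finset.sum_filter_not_add_sum_filter Finset.univ p, add_assoc]

theorem good_base {n : ℕ} (γ : ℝ) : Good γ (γ • (1 : Matrix (Fin n) (Fin n) ℝ)) := by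
  refine ⟨?_, fun x => ?_⟩
  · ext i j
    by_cases h : i = j
    · simp [h]
    · simp [Matrix.one_apply_ne h, Matrix.one_apply_ne (Ne.symm h)]
  · rw [smul_mulVec, one_mulVec, dotProduct_smul, smul_eq_mul]

theorem good_HH {n : ℕ} {ι : Type*} (S : Finset ι) (φ'' : ℝ → ℝ) (hp : ∀ x, 0 ≤ φ'' x) (γ : ℝ) (v : ι → Fin n → ℝ) (θ : Fin n → ℝ) :
    Good γ (HH S φ'' γ v θ) := (good_base γ).sum S _ (fun _ => hp _) v

theorem det_ratio {n : ℕ} {ι : Type*} [Fintype ι] [DecidableEq ι] (p : ι → Prop) [DecidablePred p] (φ'' : ℝ → ℝ) {K : ℝ}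
    (hp : ∀ x, 0 ≤ φ'' x) (hK : ∀ x, φ'' x ≤ K) {γ : ℝ} (hγ : 0 < γ) (v v' : ι → Fin n → ℝ)
    (hv : ∀ t, v t ⬝ᵥ v t = 2) (hv' : ∀ t, v' t ⬝ᵥ v' t = 2)
    (hvv : ∀ t, ¬ p t → v t = v' t) (θ : Fin n → ℝ) :
    (HH Finset.univ φ'' γ v θ).det ≤ Real.exp ((Finset.univ.filter p).card * (2 * K / γ)) * (HH Finset.univ φ'' γ v' θ).det := by
  have e : HH (Finset.univ.filter (fun t => ¬ p t)) φ'' γ v θ = HH (Finset.univ.filter (fun t => ¬ p t)) φ'' γ v' θ := by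
    rw [HH, HH]
    congr 1
    refine Finset.sum_congr rfl fun t ht => ?_
    rw [hvv t (Finset.mem_filter.1 ht).2]
  have g := good_HH (Finset.univ.filter (fun t => ¬ p t)) φ'' hp γ v' θ
  rw [HH_split p φ'' γ v, HH_split p φ'' γ v', e]
  refine (g.det_sum hγ _ _ (fun _ => hp _) (fun _ => hK _) v hv).2.trans ?_
  exact mul_le_mul_of_nonneg_left (g.det_sum hγ _ _ (fun _ => hp _) (fun _ => hK _) v' hv').1 (Real.exp_pos _).le

theorem l1_sum {n : ℕ} {ι : Type*} (S : Finset ι) (c : ι → ℝ) {K : ℝ} (hc : ∀ t, |c t| ≤ K) (v : ι → Fin n → ℝ)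
    (hv : ∀ t, ∑ i, |v t i| ≤ 2) : ∑ i, |(∑ t ∈ S, c t • v t) i| ≤ S.card * (2 * K) := by
  calc ∑ i, |(∑ t ∈ S, c t • v t) i| ≤ ∑ i, ∑ t ∈ S, |c t| * |v t i| := by
        refine Finset.sum_le_sum fun i _ => ?_
        rw [Finset.sum_apply]
        refine (Finset.abs_sum_le_sum_abs _ _).trans_eq ?_
        simp [abs_mul]
    _ = ∑ t ∈ S, |c t| * ∑ i, |v t i| := by
        rw [Finset.sum_comm]; simp [Finset.mul_sum]
    _ ≤ ∑ t ∈ S, (2 * K) := by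
        refine Finset.sum_le_sum fun t _ => ?_
        rw [mul_comm]
        exact mul_le_mul (hv t) (hc t) (abs_nonneg _) (by norm_num)
    _ = _ := by simp

theorem GG_diff {n : ℕ} {ι : Type*} [Fintype ι] [DecidableEq ι] (p : ι → Prop) [DecidablePred p] (φ' : ℝ → ℝ) {K : ℝ}
    (hK : ∀ x, |φ' x| ≤ K) (γ : ℝ) (v v' : ι → Fin n → ℝ)
    (hv : ∀ t, ∑ i, |v t i| ≤ 2) (hv' : ∀ t, ∑ i, |v' t i| ≤ 2)
    (hvv : ∀ t, ¬ p t → v t = v' t) (θ : Fin n → ℝ) :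
    ∑ i, |GG Finset.univ φ' γ v θ i - GG Finset.univ φ' γ v' θ i| ≤ (Finset.univ.filter p).card * (4 * K) := by
  have e : GG Finset.univ φ' γ v θ - GG Finset.univ φ' γ v' θ =
      (∑ t ∈ Finset.univ.filter p, φ' (v' t ⬝ᵥ θ) • v' t) - ∑ t ∈ Finset.univ.filter p, φ' (v t ⬝ᵥ θ) • v t := by
    have e2 : ∑ t ∈ Finset.univ.filter (fun t => ¬ p t), φ' (v t ⬝ᵥ θ) • v t = ∑ t ∈ Finset.univ.filter (fun t => ¬ p t), φ' (v' t ⬝ᵥ θ) • v' t :=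
      Finset.sum_congr rfl fun t ht => by rw [hvv t (Finset.mem_filter.1 ht).2]
    rw [GG, GG, ← Finset.sum_filter_not_add_sum_filter Finset.univ p, ← Finset.sum_filter_not_add_sum_filter Finset.univ p (fun t => φ' (v' t ⬝ᵥ θ) • v' t), e2]
    abel
  have h1 := l1_sum (Finset.univ.filter p) (fun t => φ' (v t ⬝ᵥ θ)) (fun _ => hK _) v hv
  have h2 := l1_sum (Finset.univ.filter p) (fun t => φ' (v' t ⬝ᵥ θ)) (fun _ => hK _) v' hv'
  have h3 : ∑ i, |GG Finset.univ φ' γ v θ i - GG Finset.univ φ' γ v' θ i| ≤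
      ∑ i, (|(∑ t ∈ Finset.univ.filter p, φ' (v' t ⬝ᵥ θ) • v' t) i| + |(∑ t ∈ Finset.univ.filter p, φ' (v t ⬝ᵥ θ) • v t) i|) := by
    refine Finset.sum_le_sum fun i _ => ?_
    rw [← Pi.sub_apply, e, Pi.sub_apply]
    exact abs_sub _ _
  rw [Finset.sum_add_distrib] at h3
  linarith

noncomputable def vec {n : ℕ} (x : Pair n × Bool) : Fin n → ℝ :=
  if x.2 then Pi.single x.1.1.1 1 - Pi.single x.1.1.2 1 else Pi.single x.1.1.2 1 - Pi.single x.1.1.1 1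

theorem vec_dot {n : ℕ} (x : Pair n × Bool) (θ : Fin n → ℝ) :
    vec x ⬝ᵥ θ = if x.2 then θ x.1.1.1 - θ x.1.1.2 else θ x.1.1.2 - θ x.1.1.1 := by
  unfold vec; split_ifs <;> simp [sub_dotProduct]

theorem vec_self {n : ℕ} (x : Pair n × Bool) : vec x ⬝ᵥ vec x = 2 := by
  have h := x.1.2.ne
  rw [vec_dot]; unfold vec
  split_ifs <;> simp [h, h.symm] <;> norm_num

theorem vec_l1 {n : ℕ} (x : Pair n × Bool) : ∑ i, |vec x i| ≤ 2 := by
  have key : ∀ a b : Fin n, ∑ i, |(Pi.single a 1 - Pi.single b 1 : Fin n → ℝ) i| ≤ 2 := by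
    intro a b
    calc _ ≤ ∑ i, ((Pi.single a 1 : Fin n → ℝ) i + (Pi.single b 1 : Fin n → ℝ) i) := by
          refine Finset.sum_le_sum fun i _ => ?_
          rw [Pi.sub_apply]
          refine (abs_sub _ _).trans_eq ?_
          rw [abs_of_nonneg, abs_of_nonneg]
          · rw [Pi.single_apply]; split_ifs <;> norm_num
          · rw [Pi.single_apply]; split_ifs <;> norm_num
      _ = 2 := by rw [Finset.sum_add_distrib]; simp; norm_num
  unfold vec; split_ifs <;> exact key _ _

theorem nllTerm_eq {n : ℕ} {F : ℝ → ℝ} (h0 : CondA0 F) (x : Pair n × Bool) (θ : Fin n → ℝ) :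
    nllTerm F (θ x.1.1.1 - θ x.1.1.2) x.2 = (fun y => -Real.log (F y)) (vec x ⬝ᵥ θ) := by
  rw [vec_dot, nllTerm]
  split_ifs
  · rfl
  · have := h0.2 (θ x.1.1.2 - θ x.1.1.1)
    rw [neg_sub] at this
    simp only [this]

/-- The law of an inverse of `GG`. -/
theorem law_eq {n : ℕ} {ι : Type*} [Fintype ι] (φ' φ'' : ℝ → ℝ) (hφ : ∀ x, HasDerivAt φ' (φ'' x) x) (hp : ∀ x, 0 ≤ φ'' x)
    {γ : ℝ} (hγ : 0 < γ) (v : ι → Fin n → ℝ) (b : ℝ) (s : (Fin n → ℝ) → (Fin n → ℝ)) (hs : Measurable s)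
    (hinv : ∀ w, GG Finset.univ φ' γ v (s w) = w) (A : Set (Fin n → ℝ)) (hA : MeasurableSet A) :
    (laplacePi n b).map s A = ∫⁻ θ in A, ENNReal.ofReal (HH Finset.univ φ'' γ v θ).det *
      ∏ i, ENNReal.ofReal ((2 * b)⁻¹ * Real.exp (-|GG Finset.univ φ' γ v θ i| / b)) := by
  have hmono : Monotone φ' := monotone_of_deriv_nonneg (fun x => (hφ x).differentiableAt) (fun x => by rw [(hφ x).deriv]; exact hp x)
  have hinj := GG_inj Finset.univ φ' hmono hγ v
  have hpre : s ⁻¹' A = GG Finset.univ φ' γ v '' A := by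
    ext w
    constructor
    · intro hw; exact ⟨s w, hw, hinv w⟩
    · rintro ⟨θ, hθ, rfl⟩
      have : s (GG Finset.univ φ' γ v θ) = θ := hinj (hinv _)
      simpa [this] using hθ
  rw [Measure.map_apply hs hA, laplacePi, pi_lap, withDensity_apply _ (hs hA), hpre,
    lintegral_image_eq_lintegral_abs_det_fderiv_mul volume hA
      (fun θ _ => (GG_deriv Finset.univ φ' φ'' hφ γ v θ).hasFDerivWithinAt) hinj.injOn]
  refine lintegral_congr fun θ => ?_
  congr 2
  have hpos := (good_HH Finset.univ φ'' hp γ v θ).det_pos hγ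
  rw [LinearMap.det_toContinuousLinearMap, LinearMap.det_toLin', det_neg, abs_mul, abs_pow]
  simp [abs_of_pos hpos]

end

/-- Proposition 5: privacy of the perturbed MLE under individual DP.
In the individual-comparison model with `m` users each contributing `L` comparisons, if
`F` satisfies (A0)-(A2), the noise scale satisfies `λ ≥ 8Lκ₁/ε` and the ridge penalty
satisfies `γ ≥ 8Lκ₂/ε`, then the perturbed MLE
`θ̃(y) = argmin_θ L(θ;y) + (γ/2)‖θ‖₂² + wᵀθ`, with `w` i.i.d. Laplace(λ), is
`(ε,0)`-individually differentially private: for datasets differing only in the `L`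
comparisons of a single user, `P(θ̃(d) ∈ A) ≤ e^ε P(θ̃(d') ∈ A)`. -/
theorem statement9 {n m L : ℕ} (F : ℝ → ℝ) (κ₁ κ₂ ε lam γ : ℝ)
    (hF0 : CondA0 F) (hF1 : CondA1 F κ₁) (hF2 : CondA2 F κ₂)
    (hε : 0 < ε) (hlam : 8 * L * κ₁ / ε ≤ lam) (hγ : 8 * L * κ₂ / ε ≤ γ)
    (sel : IndData n m L → (Fin n → ℝ) → (Fin n → ℝ))
    (hmeas : ∀ d, Measurable (sel d))
    (hmin : ∀ d w, IsMinOn (pobjInd n m L F γ w d) Set.univ (sel d w)) :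
    ∀ d d' : IndData n m L, IndAdjacent d d' →
      ∀ A : Set (Fin n → ℝ), MeasurableSet A →
        (laplacePi n lam).map (sel d) A ≤
          ENNReal.ofReal (Real.exp ε) * (laplacePi n lam).map (sel d') A := by
  intro d d' hadj A hA
  rcases Nat.eq_zero_or_pos L with hL | hL
  · subst hL
    have : d = d' := by funext k l; exact l.elim0
    subst this
    refine le_mul_of_one_le_left zero_le ?_
    rw [← ENNReal.ofReal_one]
    exact ENNReal.ofReal_le_ofReal (Real.one_le_exp hε.le)
  have hL' : (0 : ℝ) < L := by exact_mod_cast hL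
  have hκ₁ := hF1.1
  have hκ₂ := hF2.1
  have hlam0 : 0 < lam := lt_of_lt_of_le (by positivity) hlam
  have hγ0 : 0 < γ := lt_of_lt_of_le (by positivity) hγ
  obtain ⟨k₀, hk₀⟩ := hadj
  set φ : ℝ → ℝ := fun y => -Real.log (F y) with hφ
  have hd1 : ∀ x, HasDerivAt φ (deriv φ x) x := fun x => (phi_bound hF0 hF1 x).1.hasDerivAt
  have hb1 : ∀ x, |deriv φ x| ≤ κ₁ := fun x => (phi_bound hF0 hF1 x).2
  have hp2 : ∀ x, 0 ≤ deriv (deriv φ) x := fun x => (hF2.2.1 x).le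
  have hb2 : ∀ x, deriv (deriv φ) x ≤ κ₂ := fun x => (hF2.2.2.1 x).le
  have hd2 : ∀ x, HasDerivAt (deriv φ) (deriv (deriv φ) x) x := fun x =>
    (differentiableAt_of_deriv_ne_zero (hF2.2.1 x).ne').hasDerivAt
  let V : IndData n m L → Fin m × Fin L → Fin n → ℝ := fun e t => vec (e t.1 t.2)
  have hcrit : ∀ e w, GG Finset.univ (deriv φ) γ (V e) (sel e w) = w := by
    intro e w
    refine crit Finset.univ φ (deriv φ) hd1 γ (V e) w _ ?_
    have := hmin e w
    have heq : pobjInd n m L F γ w e = fun θ => ∑ t, φ (dotProduct (V e t) θ) + γ / 2 * ∑ i, θ i ^ 2 + ∑ i, w i * θ i := by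
      funext θ
      simp only [pobjInd, nllInd]
      congr 2
      rw [Fintype.sum_prod_type]
      exact Finset.sum_congr rfl fun k _ => Finset.sum_congr rfl fun l _ => nllTerm_eq hF0 _ _
    rwa [heq] at this
  rw [law_eq (deriv φ) (deriv (deriv φ)) hd2 hp2 hγ0 (V d) lam (sel d) (hmeas d) (hcrit d) A hA,
    law_eq (deriv φ) (deriv (deriv φ)) hd2 hp2 hγ0 (V d') lam (sel d') (hmeas d') (hcrit d') A hA,
    ← lintegral_const_mul' _ _ ENNReal.ofReal_ne_top]
  refine lintegral_mono fun θ => ?_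
  have hcard : ((Finset.univ.filter (fun t : Fin m × Fin L => t.1 = k₀)).card : ℝ) = L := by
    have : Finset.univ.filter (fun t : Fin m × Fin L => t.1 = k₀) = {k₀} ×ˢ Finset.univ := by
      ext t; simp [Finset.mem_product, -Finset.singleton_product]
    rw [this]; simp
  have hVV : ∀ t : Fin m × Fin L, ¬ t.1 = k₀ → V d t = V d' t := by
    intro t ht; simp only [V, hk₀ t.1 ht]
  have h1 := det_ratio (fun t : Fin m × Fin L => t.1 = k₀) (deriv (deriv φ)) hp2 hb2 hγ0 (V d) (V d')
    (fun _ => vec_self _) (fun _ => vec_self _) hVV θ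
  have h2 := GG_diff (fun t : Fin m × Fin L => t.1 = k₀) (deriv φ) hb1 γ (V d) (V d')
    (fun _ => vec_l1 _) (fun _ => vec_l1 _) hVV θ
  rw [hcard] at h1 h2
  rw [div_le_iff₀ hε] at hlam hγ
  have h3 := lap_ratio hlam0 _ _ (ε / 2) (h2.trans (by linarith))
  have h4 : (L : ℝ) * (2 * κ₂ / γ) ≤ ε / 2 := by
    rw [← mul_div_assoc, div_le_iff₀ hγ0]
    nlinarith [mul_pos hL' hκ₂]
  have hpos := (good_HH Finset.univ (deriv (deriv φ)) hp2 γ (V d') θ).det_pos hγ0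
  have h5 : ENNReal.ofReal (HH Finset.univ (deriv (deriv φ)) γ (V d) θ).det ≤
      ENNReal.ofReal (Real.exp (ε / 2)) * ENNReal.ofReal (HH Finset.univ (deriv (deriv φ)) γ (V d') θ).det := by
    rw [← ENNReal.ofReal_mul (Real.exp_pos _).le]
    refine ENNReal.ofReal_le_ofReal (h1.trans ?_)
    exact mul_le_mul_of_nonneg_right (Real.exp_le_exp.2 h4) hpos.le
  refine (mul_le_mul' h5 h3).trans_eq ?_
  have e : ENNReal.ofReal (Real.exp ε) = ENNReal.ofReal (Real.exp (ε / 2)) * ENNReal.ofReal (Real.exp (ε / 2)) := by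
    rw [← ENNReal.ofReal_mul (Real.exp_pos _).le, ← Real.exp_add, add_halves]
  rw [e]
  ring

end PrivateRanking
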